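/- Let Ω be a finite nonempty set, let E_size : Ω → ℝ and E_con : Ω → ℝ be functions, let β₁, β₂ ∈ ℝ, and set E(z) = β₁·E_size(z) + β₂·E_con(z). Let X and Z be random variables with Z taking values in Ω and joint probability mass function p. Then the mutual information is upper-bounded by the weighted expected energies up to additive constants: I(X;Z) ≤ β₁ · Σ_{x,z} p(x,z) E_size(z) + β₂ · Σ_{x,z} p(x,z) E_con(z) + log Z_E − H(Z | X), where Z_E = Σ_{z ∈ Ω} exp(−E(z)) is the partition function of the Gibbs distribution with energy E. -/

import Mathlib

/-!
Statement 8: Gibbs-prior variational upper bound on mutual information with a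
weighted-energy prior. With `E(z) = β₁·E_size(z) + β₂·E_con(z)` and partition
function `Z_E = Σ_z exp(−E(z))`,
`I(X;Z) ≤ β₁ Σ p(x,z) E_size(z) + β₂ Σ p(x,z) E_con(z) + log Z_E − H(Z|X)`.
(Natural logarithms.)
-/

open scoped BigOperators

noncomputable section

variable {X Ω : Type*} [Fintype X] [Fintype Ω]

/-- Marginal pmf of `X`. -/
def margX (p : X → Ω → ℝ) (x : X) : ℝ := ∑ z, p x z

/-- Marginal pmf of `Z`. -/
def margZ (p : X → Ω → ℝ) (z : Ω) : ℝ := ∑ x, p x z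

/-- Mutual information `I(X;Z) = Σ_{x,z} p(x,z) log( p(x,z) / (p(x) p(z)) )`. -/
def miXZ (p : X → Ω → ℝ) : ℝ :=
  ∑ x, ∑ z, p x z * Real.log (p x z / (margX p x * margZ p z))

/-- Conditional entropy `H(Z|X) = −Σ_{x,z} p(x,z) log p(z|x)`. -/
def condEntZgivenX (p : X → Ω → ℝ) : ℝ :=
  -∑ x, ∑ z, p x z * Real.log (p x z / margX p x)

/-- Gibbs' inequality: the entropy of a pmf is at most its cross-entropy relative to any positive
pmf. -/
theorem neg_sum_mul_log_le_neg_sum_mul_log {ι : Type*} [Fintype ι] (q r : ι → ℝ)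
    (hq : ∀ i, 0 ≤ q i) (hr : ∀ i, 0 < r i) (hqr : ∑ i, r i = ∑ i, q i) :
    -∑ i, q i * Real.log (q i) ≤ -∑ i, q i * Real.log (r i) := by
  have key : ∀ i, q i * Real.log (r i) - q i * Real.log (q i) ≤ r i - q i := by
    intro i
    rcases (hq i).eq_or_lt with h | h
    · simp [← h, (hr i).le]
    · have h1 := Real.log_le_sub_one_of_pos (div_pos (hr i) h)
      rw [Real.log_div (hr i).ne' h.ne'] at h1
      have h2 := mul_le_mul_of_nonneg_left h1 h.le
      rwa [mul_sub, mul_sub, mul_one, mul_div_cancel₀ _ h.ne'] at h2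
  have h := Finset.sum_le_sum fun i (_ : i ∈ Finset.univ) => key i
  simp only [Finset.sum_sub_distrib] at h
  linarith

theorem sum_sum_mul_eq_sum_margZ_mul (p : X → Ω → ℝ) (f : Ω → ℝ) :
    ∑ x, ∑ z, p x z * f z = ∑ z, margZ p z * f z := by
  rw [Finset.sum_comm]
  simp only [margZ, Finset.sum_mul]

/-- The chain rule `I(X;Z) = H(Z) − H(Z|X)`. -/
theorem miXZ_eq_entropy_sub_condEntZgivenX (p : X → Ω → ℝ) (hp : ∀ x z, 0 ≤ p x z) :
    miXZ p = -∑ z, margZ p z * Real.log (margZ p z) - condEntZgivenX p := by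
  rw [← sum_sum_mul_eq_sum_margZ_mul, miXZ, condEntZgivenX, sub_neg_eq_add, neg_add_eq_sub]
  simp only [← Finset.sum_sub_distrib]
  refine Finset.sum_congr rfl fun x _ => Finset.sum_congr rfl fun z _ => ?_
  rcases (hp x z).eq_or_lt with h | h
  · simp [← h]
  · have hx : 0 < margX p x :=
      h.trans_le (Finset.single_le_sum (fun w _ => hp x w) (Finset.mem_univ z))
    have hz : 0 < margZ p z :=
      h.trans_le (Finset.single_le_sum (fun y _ => hp y z) (Finset.mem_univ x))
    rw [← div_div, Real.log_div (div_pos h hx).ne' hz.ne', mul_sub]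

/-- With energy `E(z) = β₁·E_size(z) + β₂·E_con(z)` and
partition function `Z_E = Σ_z exp(−E(z))`, mutual information is bounded by the
weighted expected energies up to additive constants:
`I(X;Z) ≤ β₁ Σ_{x,z} p(x,z) E_size(z) + β₂ Σ_{x,z} p(x,z) E_con(z)
            + log Z_E − H(Z|X)`. -/
theorem mi_le_weighted_energy_bound
    [Nonempty X] [Nonempty Ω]
    (Esize Econ : Ω → ℝ) (β₁ β₂ : ℝ)
    (p : X → Ω → ℝ)
    (hp : ∀ x z, 0 ≤ p x z)
    (hsum : ∑ x, ∑ z, p x z = 1) :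
    miXZ p ≤
      β₁ * (∑ x, ∑ z, p x z * Esize z) + β₂ * (∑ x, ∑ z, p x z * Econ z) +
        Real.log (∑ w, Real.exp (-(β₁ * Esize w + β₂ * Econ w))) -
        condEntZgivenX p := by
  set E : Ω → ℝ := fun z => β₁ * Esize z + β₂ * Econ z
  set Z : ℝ := ∑ w, Real.exp (-E w)
  have hZ : 0 < Z := Finset.sum_pos (fun w _ => Real.exp_pos _) Finset.univ_nonempty
  have hmarg : ∑ z, margZ p z = 1 := by
    rw [← hsum, Finset.sum_comm]
    rfl
  have hG := neg_sum_mul_log_le_neg_sum_mul_log (margZ p) (fun z => Real.exp (-E z) / Z)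
    (fun z => Finset.sum_nonneg fun x _ => hp x z) (fun z => div_pos (Real.exp_pos _) hZ)
    (by rw [hmarg, ← Finset.sum_div, div_self hZ.ne'])
  have hcross : -∑ z, margZ p z * Real.log (Real.exp (-E z) / Z) =
      β₁ * (∑ z, margZ p z * Esize z) + β₂ * (∑ z, margZ p z * Econ z) + Real.log Z := by
    rw [← one_mul (Real.log Z), ← hmarg, Finset.mul_sum, Finset.mul_sum, Finset.sum_mul,
      ← Finset.sum_add_distrib, ← Finset.sum_add_distrib, ← Finset.sum_neg_distrib]
    refine Finset.sum_congr rfl fun z _ => ?_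
    rw [Real.log_div (Real.exp_pos _).ne' hZ.ne', Real.log_exp]
    ring
  rw [miXZ_eq_entropy_sub_condEntZgivenX p hp, sum_sum_mul_eq_sum_margZ_mul,
    sum_sum_mul_eq_sum_margZ_mul]
  linarith
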